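/- arXiv:1903.05006 — 2 statements merged into one kernel-verified Lean document; each statement's English description precedes it below -/
import Mathlib

section
/- Let A be a real m×n matrix, b ∈ ℝ^m, B a real s×n matrix, d ∈ ℝ^s, and λ > 0. Let f(x) = (1/2)‖Ax − b‖² + λ‖x‖₁ and S be the set of minimizers of f over C = {x : Bx = d}. Suppose S is nonempty, x̄ ∈ S, and there exists a multiplier v̄ ∈ ℝ^s such that Bᵀv̄ − Aᵀ(Ax̄ − b) ∈ λ·∂‖·‖₁(x̄). Then the second-order growth condition holds at x̄: there exist κ > 0 and ε > 0 such that for every x ∈ ℝⁿ with ‖x − x̄‖ < ε and Bx = d, one has f(x) ≥ f(x̄) + κ·dist(x, S)², where dist(x, S) = inf_{y∈S} ‖x − y‖. (This is the second-order growth formulation equivalent to metric subregularity of the map T_φ at x̄ for 0.) -/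
open Matrix

/-- Euclidean norm on `Fin n → ℝ`. -/
noncomputable def euclNorm {n : ℕ} (x : Fin n → ℝ) : ℝ := Real.sqrt (∑ i, x i ^ 2)

/-- Euclidean inner product on `Fin n → ℝ`. -/
def dotp {n : ℕ} (x y : Fin n → ℝ) : ℝ := ∑ i, x i * y i

/-- ℓ₁ norm on `Fin n → ℝ`. -/
def l1norm {n : ℕ} (x : Fin n → ℝ) : ℝ := ∑ i, |x i|

/-- Euclidean distance from a point to a set: `inf_{y ∈ S} ‖x − y‖`. -/
noncomputable def distSet {n : ℕ} (x : Fin n → ℝ) (S : Set (Fin n → ℝ)) : ℝ :=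
  sInf ((fun y => euclNorm (x - y)) '' S)

/-- Subdifferential of a (convex) function `g` at `x`. -/
def subdiff {n : ℕ} (g : (Fin n → ℝ) → ℝ) (x : Fin n → ℝ) : Set (Fin n → ℝ) :=
  {s : Fin n → ℝ | ∀ y, g y ≥ g x + dotp s (y - x)}
/-- On a closed sign cone, a nonnegative continuous positively homogeneous function vanishing only
at the origin dominates a multiple of the `ℓ₁` norm. -/
lemma exists_pos_mul_l1norm_le {n : ℕ} (R : (Fin n → ℝ) → ℝ) (hc : Continuous R)
    (h0 : ∀ z, 0 ≤ R z) (hh : ∀ t : ℝ, 0 ≤ t → ∀ z, R (t • z) = t * R z) (σ : Fin n → SignType)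
    (hker : ∀ z, (∀ i, z i * (σ i : ℝ) = |z i|) → R z = 0 → z = 0) :
    ∃ c > 0, ∀ z, (∀ i, z i * (σ i : ℝ) = |z i|) → c * l1norm z ≤ R z := by
  have hl1 : Continuous (l1norm : (Fin n → ℝ) → ℝ) := by unfold l1norm; fun_prop
  have hK : IsCompact {z : Fin n → ℝ | (∀ i, z i * (σ i : ℝ) = |z i|) ∧ l1norm z = 1} := by
    refine (isCompact_closedBall (0 : Fin n → ℝ) 1).of_isClosed_subset ?_ ?_
    · have : IsClosed {z : Fin n → ℝ | ∀ i, z i * (σ i : ℝ) = |z i|} := by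
        rw [Set.ofPred_forall]
        exact isClosed_iInter fun i => isClosed_eq (by fun_prop) (by fun_prop)
      exact this.inter (isClosed_eq hl1 continuous_const)
    · rintro z ⟨-, hz⟩
      rw [mem_closedBall_zero_iff, pi_norm_le_iff_of_nonneg zero_le_one]
      intro i
      rw [← hz, Real.norm_eq_abs]
      exact Finset.single_le_sum (f := fun i => |z i|) (fun _ _ => abs_nonneg _)
        (Finset.mem_univ i)
  obtain ⟨c, hcpos, hcle⟩ : ∃ c > 0, ∀ z : Fin n → ℝ, (∀ i, z i * (σ i : ℝ) = |z i|) →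
      l1norm z = 1 → c ≤ R z := by
    rcases Set.eq_empty_or_nonempty
      {z : Fin n → ℝ | (∀ i, z i * (σ i : ℝ) = |z i|) ∧ l1norm z = 1} with he | hne
    · exact ⟨1, one_pos, fun z h1 h2 => absurd (he ▸ ⟨h1, h2⟩ : z ∈ (∅ : Set _)) (by simp)⟩
    · obtain ⟨z, ⟨hz1, hz2⟩, hmin⟩ := hK.exists_isMinOn hne hc.continuousOn
      refine ⟨R z, lt_of_le_of_ne (h0 z) fun h => ?_, fun y h1 h2 => hmin ⟨h1, h2⟩⟩
      have := hker z hz1 h.symm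
      simp [this, l1norm] at hz2
  refine ⟨c, hcpos, fun z hz => ?_⟩
  have hnn : 0 ≤ l1norm z := Finset.sum_nonneg fun _ _ => abs_nonneg _
  rcases hnn.eq_or_lt with h | h
  · rw [← h, mul_zero]; exact h0 z
  · have hi : 0 ≤ (l1norm z)⁻¹ := inv_nonneg.2 hnn
    have h1 := hcle ((l1norm z)⁻¹ • z)
      (fun i => by simp [abs_mul, abs_of_nonneg hi, mul_assoc, hz i])
      (by
        have : l1norm ((l1norm z)⁻¹ • z) = (l1norm z)⁻¹ * l1norm z := by
          generalize (l1norm z)⁻¹ = t at hi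
          simp [l1norm, abs_mul, abs_of_nonneg hi, Finset.mul_sum]
        rw [this, inv_mul_cancel₀ h.ne'])
    rw [hh _ hi] at h1
    calc c * l1norm z ≤ ((l1norm z)⁻¹ * R z) * l1norm z := by gcongr
      _ = R z := by field_simp

/-- Removing from `h = p + q` a further part `u` of `q` of the same sign as `q`. -/
lemma conformal_add {h p u : ℝ} {σ : SignType} (hσ : σ = SignType.sign (h - p))
    (hp : |p| + |h - p| = |h|) (hu : u * (σ : ℝ) = |u|) (hle : |u| ≤ |h - p|) :
    |p + u| + |h - (p + u)| = |h| ∧ |p + u| = |p| + |u| := by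
  rcases lt_trichotomy (h - p) 0 with hq | hq | hq
  · rw [sign_neg hq] at hσ
    subst hσ
    simp only [SignType.coe_neg_one] at hu
    have : u ≤ 0 := by linarith [abs_nonneg u]
    have hp0 : p ≤ 0 := by grind
    rw [abs_of_neg hq, abs_of_nonpos this] at hle
    rw [abs_of_nonpos (by linarith : p + u ≤ 0), abs_of_nonpos hp0, abs_of_nonpos this,
      abs_of_nonpos (by linarith : h - (p + u) ≤ 0), abs_of_nonpos (by linarith : h ≤ 0)]
    constructor <;> ring
  · have : u = 0 := by rw [hq, abs_zero] at hle; exact abs_nonpos_iff.1 hle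
    simp [this, hp]
  · rw [sign_pos hq] at hσ
    subst hσ
    simp only [SignType.coe_one, mul_one] at hu
    have : 0 ≤ u := by linarith [abs_nonneg u]
    have hp0 : 0 ≤ p := by grind
    rw [abs_of_pos hq, abs_of_nonneg this] at hle
    rw [abs_of_nonneg (by linarith : 0 ≤ p + u), abs_of_nonneg hp0, abs_of_nonneg this,
      abs_of_nonneg (by linarith : 0 ≤ h - (p + u)), abs_of_nonneg (by linarith : 0 ≤ h)]
    constructor <;> ring

/-- A Hoffman-type error bound for the zero set of a nonnegative sublinear function `R`, in which
the approximating zero `p` is conformal to `h`. -/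
lemma exists_conformal_error_bound {n : ℕ} (R : (Fin n → ℝ) → ℝ) (hc : Continuous R)
    (h0 : ∀ z, 0 ≤ R z) (hh : ∀ t : ℝ, 0 ≤ t → ∀ z, R (t • z) = t * R z)
    (hadd : ∀ y z, R (y + z) ≤ R y + R z) :
    ∃ c > 0, ∀ h, ∃ p, (∀ i, |p i| + |h i - p i| = |h i|) ∧ R p = 0 ∧
      c * l1norm (h - p) ≤ R (h - p) := by
  have key : ∀ σ : Fin n → SignType, ∃ c > 0,
      (∀ z, (∀ i, z i * (σ i : ℝ) = |z i|) → R z = 0 → z = 0) →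
        ∀ z, (∀ i, z i * (σ i : ℝ) = |z i|) → c * l1norm z ≤ R z := by
    intro σ
    by_cases hker : ∀ z, (∀ i, z i * (σ i : ℝ) = |z i|) → R z = 0 → z = 0
    · obtain ⟨c, hc, h⟩ := exists_pos_mul_l1norm_le R hc h0 hh σ hker
      exact ⟨c, hc, fun _ => h⟩
    · exact ⟨1, one_pos, fun h => absurd h hker⟩
  choose c hcpos hcle using key
  obtain ⟨σ₀, hσ₀⟩ := Finite.exists_min c
  refine ⟨c σ₀, hcpos σ₀, fun h => ?_⟩
  have hl1 : Continuous (l1norm : (Fin n → ℝ) → ℝ) := by unfold l1norm; fun_prop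
  have hK : IsCompact {p : Fin n → ℝ | (∀ i, |p i| + |h i - p i| = |h i|) ∧ R p = 0} := by
    refine (isCompact_closedBall (0 : Fin n → ℝ) ‖h‖).of_isClosed_subset ?_ ?_
    · have : IsClosed {p : Fin n → ℝ | ∀ i, |p i| + |h i - p i| = |h i|} := by
        rw [Set.ofPred_forall]
        exact isClosed_iInter fun i => isClosed_eq (by fun_prop) (by fun_prop)
      exact this.inter (isClosed_eq hc continuous_const)
    · rintro p ⟨hp, -⟩
      rw [mem_closedBall_zero_iff, pi_norm_le_iff_of_nonneg (norm_nonneg _)]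
      intro i
      have h1 := norm_le_pi_norm h i
      rw [Real.norm_eq_abs] at h1 ⊢
      linarith [hp i, abs_nonneg (h i - p i)]
  have hR0 : R 0 = 0 := by simpa using hh 0 le_rfl 0
  obtain ⟨p, ⟨hp, hRp⟩, hmax⟩ := hK.exists_isMaxOn ⟨0, by simp [hR0]⟩ hl1.continuousOn
  refine ⟨p, hp, hRp, ?_⟩
  let σ : Fin n → SignType := fun i => SignType.sign (h i - p i)
  have hnn : 0 ≤ l1norm (h - p) := Finset.sum_nonneg fun _ _ => abs_nonneg _
  refine (mul_le_mul_of_nonneg_right (hσ₀ σ) hnn).trans (hcle σ ?_ (h - p) fun i => ?_)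
  · intro z hz hRz
    obtain ⟨t, htle, ht⟩ : ∃ t : ℝ, (∀ i, t * |z i| ≤ |h i - p i|) ∧ 0 < t := by
      have : ∀ᶠ t : ℝ in nhdsWithin 0 (Set.Ioi 0), ∀ i, t * |z i| ≤ |h i - p i| := by
        rw [Filter.eventually_all]
        intro i
        by_cases hq : h i - p i = 0
        · have := hz i
          simp only [σ, hq, sign_zero, SignType.coe_zero, mul_zero] at this
          simp [← this]
        · have ht : Filter.Tendsto (fun t : ℝ => t * |z i|) (nhdsWithin 0 (Set.Ioi 0))
              (nhds (0 * |z i|)) :=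
            ((continuous_id.mul continuous_const).tendsto 0).mono_left nhdsWithin_le_nhds
          rw [zero_mul] at ht
          exact ht.eventually_le_const (abs_pos.2 hq)
      exact (this.and self_mem_nhdsWithin).exists
    have hconf := fun i => conformal_add (h := h i) (p := p i) (u := t * z i) (σ := σ i) rfl (hp i)
      (by rw [mul_assoc, hz i, abs_mul, abs_of_pos ht])
      (by rw [abs_mul, abs_of_pos ht]; exact htle i)
    have hmem : l1norm (p + t • z) ≤ l1norm p := by
      refine hmax ⟨fun i => (hconf i).1, le_antisymm ?_ (h0 _)⟩
      have := hadd p (t • z)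
      rwa [hh t ht.le, hRz, hRp, mul_zero, add_zero] at this
    have hsum : l1norm (p + t • z) = l1norm p + t * ∑ i, |z i| := by
      simp only [l1norm, Finset.mul_sum, ← Finset.sum_add_distrib]
      refine Finset.sum_congr rfl fun i _ => ?_
      rw [Pi.add_apply, Pi.smul_apply, smul_eq_mul, (hconf i).2, abs_mul, abs_of_pos ht]
    have hz0 : ∑ i, |z i| = 0 :=
      le_antisymm (by nlinarith) (Finset.sum_nonneg fun _ _ => abs_nonneg _)
    rw [Finset.sum_eq_zero_iff_of_nonneg fun _ _ => abs_nonneg _] at hz0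
    funext i
    exact abs_eq_zero.1 (hz0 i (Finset.mem_univ i))
  · exact self_mul_sign _

lemma euclNorm_sq {n : ℕ} (x : Fin n → ℝ) : euclNorm x ^ 2 = ∑ i, x i ^ 2 :=
  Real.sq_sqrt (Finset.sum_nonneg fun _ _ => sq_nonneg _)

lemma euclNorm_nonneg {n : ℕ} (x : Fin n → ℝ) : 0 ≤ euclNorm x := Real.sqrt_nonneg _

lemma abs_le_euclNorm {n : ℕ} (x : Fin n → ℝ) (i : Fin n) : |x i| ≤ euclNorm x := by
  refine abs_le_of_sq_le_sq ?_ (euclNorm_nonneg x)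
  rw [euclNorm_sq]
  exact Finset.single_le_sum (f := fun i => x i ^ 2) (fun _ _ => sq_nonneg _) (Finset.mem_univ i)

lemma norm_le_euclNorm {n : ℕ} (x : Fin n → ℝ) : ‖x‖ ≤ euclNorm x :=
  (pi_norm_le_iff_of_nonneg (euclNorm_nonneg x)).2 fun i => abs_le_euclNorm x i

lemma euclNorm_le_l1norm {n : ℕ} (x : Fin n → ℝ) : euclNorm x ≤ l1norm x := by
  refine Real.sqrt_le_iff.2 ⟨Finset.sum_nonneg fun _ _ => abs_nonneg _, ?_⟩
  simpa [l1norm] using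
    Finset.sum_sq_le_sq_sum_of_nonneg (s := Finset.univ) (f := fun i => |x i|)
      fun i _ => abs_nonneg _

lemma distSet_nonneg {n : ℕ} (x : Fin n → ℝ) (S : Set (Fin n → ℝ)) : 0 ≤ distSet x S :=
  Real.sInf_nonneg (by rintro _ ⟨y, -, rfl⟩; exact euclNorm_nonneg _)

lemma distSet_le {n : ℕ} (x : Fin n → ℝ) {S : Set (Fin n → ℝ)} {y : Fin n → ℝ} (hy : y ∈ S) :
    distSet x S ≤ euclNorm (x - y) :=
  csInf_le ⟨0, by rintro _ ⟨y, -, rfl⟩; exact euclNorm_nonneg _⟩ ⟨y, hy, rfl⟩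

/-- Subgradients of the `ℓ₁` norm are subgradients coordinatewise. -/
lemma abs_add_ge_of_mem_subdiff {n : ℕ} {g x : Fin n → ℝ} (hg : g ∈ subdiff l1norm x)
    (i : Fin n) (t : ℝ) : 0 ≤ |x i + t| - |x i| - g i * t := by
  have h := hg (x + Pi.single i t)
  have h1 : l1norm (x + Pi.single i t) - l1norm x = |x i + t| - |x i| := by
    rw [l1norm, l1norm, ← Finset.sum_sub_distrib, Finset.sum_eq_single i]
    · simp
    · intro j _ hj
      simp [hj]
    · simp
  have h2 : dotp g (x + Pi.single i t - x) = g i * t := by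
    rw [dotp, Finset.sum_eq_single i]
    · simp
    · intro j _ hj
      simp [hj]
    · simp
  rw [h2] at h
  linarith

/-- Exact expansion of the Lasso objective around a KKT point along the kernel of `B`. -/
lemma lasso_expansion {m n s : ℕ} (A : Matrix (Fin m) (Fin n) ℝ) (b : Fin m → ℝ)
    (B : Matrix (Fin s) (Fin n) ℝ) (lam : ℝ) (x g h : Fin n → ℝ) (v : Fin s → ℝ)
    (hkkt : Bᵀ *ᵥ v - Aᵀ *ᵥ (A *ᵥ x - b) = lam • g) (hB : B *ᵥ h = 0) :
    (1 / 2) * euclNorm (A *ᵥ (x + h) - b) ^ 2 + lam * l1norm (x + h) =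
      ((1 / 2) * euclNorm (A *ᵥ x - b) ^ 2 + lam * l1norm x) +
        ((1 / 2) * euclNorm (A *ᵥ h) ^ 2 +
          lam * ∑ i, (|x i + h i| - |x i| - g i * h i)) := by
  have hcross : (A *ᵥ x - b) ⬝ᵥ (A *ᵥ h) = -(lam * (g ⬝ᵥ h)) := by
    have h1 : (lam • g) ⬝ᵥ h = v ⬝ᵥ (B *ᵥ h) - (A *ᵥ x - b) ⬝ᵥ (A *ᵥ h) := by
      rw [← hkkt, sub_dotProduct, mulVec_transpose, mulVec_transpose, ← dotProduct_mulVec,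
        ← dotProduct_mulVec]
    rw [hB, dotProduct_zero, smul_dotProduct, smul_eq_mul] at h1
    linarith
  have hsq : euclNorm (A *ᵥ (x + h) - b) ^ 2 =
      euclNorm (A *ᵥ x - b) ^ 2 + 2 * ((A *ᵥ x - b) ⬝ᵥ (A *ᵥ h)) + euclNorm (A *ᵥ h) ^ 2 := by
    simp only [euclNorm_sq, dotProduct, Finset.mul_sum, ← Finset.sum_add_distrib, mulVec_add]
    refine Finset.sum_congr rfl fun i _ => ?_
    simp only [Pi.add_apply, Pi.sub_apply]
    ring
  have hl : ∑ i, (|x i + h i| - |x i| - g i * h i) = l1norm (x + h) - l1norm x - g ⬝ᵥ h := by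
    simp [l1norm, dotProduct, Finset.sum_sub_distrib]
  rw [hsq, hcross, hl]
  ring

/-- **Second-order growth for the constrained Lasso** (Theorem 1 / metric subregularity of
`T_φ` at `x̄` for `0`, in its equivalent second-order growth formulation):
if the solution set `S` of `min f(x) = (1/2)‖Ax−b‖² + λ‖x‖₁ s.t. Bx = d` is nonempty,
`x̄ ∈ S`, and a KKT multiplier `v̄` exists with `Bᵀv̄ − Aᵀ(Ax̄−b) ∈ λ∂‖·‖₁(x̄)`, then there
are `κ > 0`, `ε > 0` such that `f(x) ≥ f(x̄) + κ · dist(x,S)²` for all feasible `x` near `x̄`. -/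
theorem constrained_lasso_second_order_growth
    {m n s : ℕ} (A : Matrix (Fin m) (Fin n) ℝ) (b : Fin m → ℝ)
    (B : Matrix (Fin s) (Fin n) ℝ) (d : Fin s → ℝ)
    (lam : ℝ) (hlam : 0 < lam)
    (f : (Fin n → ℝ) → ℝ)
    (hf : f = fun x => (1 / 2) * euclNorm (A.mulVec x - b) ^ 2 + lam * l1norm x)
    (S : Set (Fin n → ℝ))
    (hS : S = {x | B.mulVec x = d ∧ ∀ y, B.mulVec y = d → f x ≤ f y})
    (hSne : S.Nonempty)
    (xbar : Fin n → ℝ) (hxbar : xbar ∈ S)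
    (vbar : Fin s → ℝ)
    (hkkt : ∃ g ∈ subdiff l1norm xbar,
      Bᵀ *ᵥ vbar - Aᵀ *ᵥ (A *ᵥ xbar - b) = lam • g) :
    ∃ κ > 0, ∃ ε > 0, ∀ x : Fin n → ℝ,
      euclNorm (x - xbar) < ε → B.mulVec x = d →
        f x ≥ f xbar + κ * distSet x S ^ 2 := by
  obtain ⟨g, hg, hkkt⟩ := hkkt
  have hsub := fun i t => abs_add_ge_of_mem_subdiff hg i t
  have hexp : ∀ h, B *ᵥ h = 0 → f (xbar + h) = f xbar + ((1 / 2) * euclNorm (A *ᵥ h) ^ 2 +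
      lam * ∑ i, (|xbar i + h i| - |xbar i| - g i * h i)) := by
    intro h hB
    rw [hf]
    exact lasso_expansion A b B lam xbar g h vbar hkkt hB
  let ψ : (Fin n → ℝ) → ℝ := fun z => ∑ i, if xbar i = 0 then |z i| - g i * z i else 0
  have hterm : ∀ (z : Fin n → ℝ) i, 0 ≤ if xbar i = 0 then |z i| - g i * z i else 0 := by
    intro z i
    split_ifs with hx
    · simpa [hx] using hsub i (z i)
    · exact le_rfl
  have hψ0 : ∀ z, 0 ≤ ψ z := fun z => Finset.sum_nonneg fun i _ => hterm z i
  let R : (Fin n → ℝ) → ℝ := fun z => ‖A *ᵥ z‖ + ‖B *ᵥ z‖ + ψ z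
  have hRc : Continuous R := by
    refine ((Continuous.matrix_mulVec continuous_const continuous_id).norm.add
      (Continuous.matrix_mulVec continuous_const continuous_id).norm).add
      (continuous_finsetSum _ fun i _ => ?_)
    split_ifs <;> fun_prop
  have hR0 : ∀ z, 0 ≤ R z := fun z => by
    have := hψ0 z
    positivity
  have hRh : ∀ t : ℝ, 0 ≤ t → ∀ z, R (t • z) = t * R z := by
    intro t ht z
    have : ψ (t • z) = t * ψ z := by
      simp only [ψ, Finset.mul_sum]
      refine Finset.sum_congr rfl fun i _ => ?_
      split_ifs
      · rw [Pi.smul_apply, smul_eq_mul, abs_mul, abs_of_nonneg ht]; ring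
      · simp
    simp only [R, this, mulVec_smul, norm_smul, Real.norm_eq_abs, abs_of_nonneg ht]
    ring
  have hRadd : ∀ y z, R (y + z) ≤ R y + R z := by
    intro y z
    have h1 : ψ (y + z) ≤ ψ y + ψ z := by
      simp only [ψ, ← Finset.sum_add_distrib]
      refine Finset.sum_le_sum fun i _ => ?_
      split_ifs
      · rw [Pi.add_apply]; linarith [abs_add_le (y i) (z i)]
      · simp
    simp only [R, mulVec_add]
    linarith [norm_add_le (A *ᵥ y) (A *ᵥ z), norm_add_le (B *ᵥ y) (B *ᵥ z)]
  obtain ⟨c, hc, hbound⟩ := exists_conformal_error_bound R hRc hR0 hRh hRadd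
  obtain ⟨ε, hε, hεpos, hε1⟩ : ∃ ε : ℝ, (∀ i, xbar i ≠ 0 → ε ≤ |xbar i|) ∧ 0 < ε ∧ ε ≤ 1 := by
    have h1 : ∀ᶠ ε : ℝ in nhdsWithin 0 (Set.Ioi 0), ∀ i, xbar i ≠ 0 → ε ≤ |xbar i| := by
      rw [Filter.eventually_all]
      intro i
      by_cases hx : xbar i = 0
      · simp [hx]
      · filter_upwards [Ioc_mem_nhdsGT (abs_pos.2 hx)] with ε hε _ using hε.2
    exact (h1.and (Ioc_mem_nhdsGT one_pos)).exists
  let M : ℝ := 2 * n + 1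
  have hM : 0 < M := by positivity
  refine ⟨c ^ 2 * min (1 / 4) (lam / (2 * M)), by positivity, ε, hεpos, fun x hx hBx => ?_⟩
  have hBbar : B *ᵥ xbar = d := by rw [hS] at hxbar; exact hxbar.1
  obtain ⟨h, rfl⟩ : ∃ h, x = xbar + h := ⟨x - xbar, by abel⟩
  rw [add_sub_cancel_left] at hx
  have hBh : B *ᵥ h = 0 := by
    rw [mulVec_add, hBbar] at hBx
    simpa using hBx
  have hhi : ∀ i, |h i| < ε := fun i => (abs_le_euclNorm h i).trans_lt hx
  obtain ⟨p, hp, hRp, hcp⟩ := hbound h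
  have hψp : ψ p = 0 := by
    have h1 := hψ0 p
    simp only [R] at hRp
    linarith [norm_nonneg (A *ᵥ p), norm_nonneg (B *ᵥ p)]
  have hAp : A *ᵥ p = 0 := by
    simp only [R] at hRp
    exact norm_eq_zero.1 (by linarith [norm_nonneg (A *ᵥ p), norm_nonneg (B *ᵥ p)])
  have hBp : B *ᵥ p = 0 := by
    simp only [R] at hRp
    exact norm_eq_zero.1 (by linarith [norm_nonneg (A *ᵥ p), norm_nonneg (B *ᵥ p)])
  have hfp : f (xbar + p) = f xbar := by
    have hz : ∀ i, |xbar i + p i| - |xbar i| - g i * p i = 0 := by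
      intro i
      by_cases hxi : xbar i = 0
      · have := (Finset.sum_eq_zero_iff_of_nonneg fun i _ => hterm p i).1 hψp i (Finset.mem_univ i)
        simpa [hxi] using this
      · have hpi : |p i| ≤ |xbar i| := by
          linarith [hp i, abs_nonneg (h i - p i), hhi i, hε i hxi]
        have h1 := hsub i (xbar i)
        have h2 := hsub i (-xbar i)
        rcases lt_or_gt_of_ne hxi with hneg | hpos
        · rw [abs_of_neg hneg] at *
          rw [abs_of_neg (by linarith)] at h1
          rw [add_neg_cancel, abs_zero] at h2
          have : g i = -1 := by
            have : (g i + 1) * xbar i = 0 := by linarith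
            rcases mul_eq_zero.1 this with h | h
            · linarith
            · exact absurd h hxi
          rw [this, abs_of_nonpos (by linarith [le_abs_self (p i)])]
          ring
        · rw [abs_of_pos hpos] at *
          rw [abs_of_pos (by linarith)] at h1
          rw [add_neg_cancel, abs_zero] at h2
          have : g i = 1 := by
            have : (g i - 1) * xbar i = 0 := by linarith
            rcases mul_eq_zero.1 this with h | h
            · linarith
            · exact absurd h hxi
          rw [this, abs_of_nonneg (by linarith [neg_abs_le (p i)])]
          ring
    rw [hexp p hBp, hAp, Finset.sum_eq_zero fun i _ => hz i]
    simp [euclNorm]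
  have hmem : xbar + p ∈ S := by
    rw [hS] at hxbar ⊢
    refine ⟨by rw [mulVec_add, hBp, hBbar, add_zero], fun y hy => ?_⟩
    rw [hfp]
    exact hxbar.2 y hy
  have hdist : c * distSet (xbar + h) S ≤ euclNorm (A *ᵥ h) + ψ h := by
    have h1 : distSet (xbar + h) S ≤ l1norm (h - p) := by
      have := distSet_le (xbar + h) hmem
      rw [add_sub_add_left_eq_sub] at this
      exact this.trans (euclNorm_le_l1norm _)
    have h2 : ψ (h - p) = ψ h := by
      rw [← sub_zero (ψ h), ← hψp]
      simp only [ψ, ← Finset.sum_sub_distrib]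
      refine Finset.sum_congr rfl fun i _ => ?_
      split_ifs
      · rw [Pi.sub_apply]; linarith [hp i]
      · simp
    have h3 : R (h - p) = ‖A *ᵥ h‖ + ψ h := by
      simp [R, h2, mulVec_sub, hAp, hBp, hBh]
    rw [h3] at hcp
    linarith [mul_le_mul_of_nonneg_left h1 hc.le, norm_le_euclNorm (A *ᵥ h)]
  have hψM : ψ h ≤ M := by
    have : ψ h ≤ ∑ _i : Fin n, (2 : ℝ) := by
      refine Finset.sum_le_sum fun i _ => ?_
      split_ifs with hxi
      · have h1 := hsub i (-h i)
        simp only [hxi, zero_add, abs_neg, abs_zero] at h1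
        linarith [hhi i]
      · norm_num
    simp only [Finset.sum_const, Finset.card_univ, Fintype.card_fin, nsmul_eq_mul] at this
    simp only [M]
    linarith
  have hψle : ψ h ≤ ∑ i, (|xbar i + h i| - |xbar i| - g i * h i) := by
    refine Finset.sum_le_sum fun i _ => ?_
    split_ifs with hxi
    · simp [hxi]
    · exact hsub i (h i)
  rw [hexp h hBh]
  have hsq : (c * distSet (xbar + h) S) ^ 2 ≤ 2 * euclNorm (A *ᵥ h) ^ 2 + 2 * M * ψ h := by
    have h1 := pow_le_pow_left₀ (mul_nonneg hc.le (distSet_nonneg _ _)) hdist 2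
    nlinarith [sq_nonneg (euclNorm (A *ᵥ h) - ψ h), mul_le_mul_of_nonneg_right hψM (hψ0 h)]
  set μ := min (1 / 4) (lam / (2 * M))
  have hμ : 0 ≤ μ := by positivity
  have hμ1 : μ ≤ 1 / 4 := min_le_left _ _
  have hμ2 : μ * (2 * M) ≤ lam := (le_div_iff₀ (by positivity)).1 (min_le_right _ _)
  have e1 := mul_le_mul_of_nonneg_left hsq hμ
  have e2 := mul_le_mul_of_nonneg_right hμ1 (sq_nonneg (euclNorm (A *ᵥ h)))
  have e3 := mul_le_mul_of_nonneg_right hμ2 (hψ0 h)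
  have e4 := mul_le_mul_of_nonneg_left hψle hlam.le
  nlinarith
end

section
/- Let A be a real m×n matrix, b ∈ ℝ^m, λ > 0, and let D be a real p×n matrix with rank(D) = n (i.e., D is injective). Let D† = (DᵀD)⁻¹Dᵀ be the Moore–Penrose pseudoinverse of D, and let U₂ be a real p×s matrix such that {z ∈ ℝᵖ : U₂ᵀz = 0} equals the column space (range) of D. Then for any x̄ ∈ ℝⁿ, x̄ minimizes the generalized Lasso objective (1/2)‖Ax − b‖² + λ‖Dx‖₁ over ℝⁿ if and only if z̄ = Dx̄ minimizes the constrained Lasso objective (1/2)‖AD†z − b‖² + λ‖z‖₁ over {z ∈ ℝᵖ : U₂ᵀz = 0}; moreover, every minimizer z̄ of the constrained problem satisfies z̄ = Dx̄ for the minimizer x̄ = D†z̄ of the generalized Lasso problem. -/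
open Matrix

/-- The pseudoinverse `(DᵀD)⁻¹Dᵀ` of a matrix of full column rank is a left inverse. -/
theorem pinv_mul_self_of_rank_eq {p n : ℕ} (D : Matrix (Fin p) (Fin n) ℝ) (hD : D.rank = n) :
    (Dᵀ * D)⁻¹ * Dᵀ * D = 1 := by
  have hinj : Function.Injective D.mulVec := by
    rw [Matrix.mulVec_injective_iff, linearIndependent_iff_card_eq_finrank_span, Set.finrank,
      ← Matrix.rank_eq_finrank_span_cols, hD, Fintype.card_fin]
  have hunit : IsUnit (Dᵀ * D) := by
    rw [← Matrix.mulVec_injective_iff_isUnit]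
    refine (injective_iff_map_eq_zero (Dᵀ * D).mulVecLin).2 fun x hx => ?_
    have hDx : D *ᵥ x = 0 := by
      rwa [mulVecLin_apply, ← conjTranspose_eq_transpose_of_trivial,
        conjTranspose_mul_self_mulVec_eq_zero] at hx
    exact hinj (by simpa using hDx)
  rw [Matrix.mul_assoc, Matrix.nonsing_inv_mul _ ((Matrix.isUnit_iff_isUnit_det _).1 hunit)]

/-- **Equivalence of generalized Lasso and constrained Lasso** (transformation (5.3)):
if `D` has full column rank `n`, `D† = (DᵀD)⁻¹Dᵀ`, and `U₂` satisfies
`{z : U₂ᵀz = 0} = range(D)`, then `x̄` minimizes `(1/2)‖Ax−b‖² + λ‖Dx‖₁` over `ℝⁿ`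
iff `z̄ = Dx̄` minimizes `(1/2)‖AD†z−b‖² + λ‖z‖₁` over `{z : U₂ᵀz = 0}`; moreover
each minimizer `z̄` of the constrained problem satisfies `z̄ = D(D†z̄)` where
`x̄ = D†z̄` minimizes the generalized Lasso problem. -/
theorem generalized_lasso_iff_constrained_lasso
    {m n p s : ℕ} (A : Matrix (Fin m) (Fin n) ℝ) (b : Fin m → ℝ)
    (lam : ℝ) (hlam : 0 < lam)
    (D : Matrix (Fin p) (Fin n) ℝ) (hD : D.rank = n)
    (Ddag : Matrix (Fin n) (Fin p) ℝ) (hDdag : Ddag = (Dᵀ * D)⁻¹ * Dᵀ)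
    (U₂ : Matrix (Fin p) (Fin s) ℝ)
    (hU₂ : {z : Fin p → ℝ | U₂ᵀ *ᵥ z = 0} = {z : Fin p → ℝ | ∃ x, D *ᵥ x = z})
    (fgen : (Fin n → ℝ) → ℝ)
    (hfgen : fgen = fun x =>
      (1 / 2) * euclNorm (A *ᵥ x - b) ^ 2 + lam * l1norm (D *ᵥ x))
    (fcon : (Fin p → ℝ) → ℝ)
    (hfcon : fcon = fun z =>
      (1 / 2) * euclNorm (A *ᵥ (Ddag *ᵥ z) - b) ^ 2 + lam * l1norm z) :
    (∀ xbar : Fin n → ℝ,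
      (∀ x, fgen xbar ≤ fgen x) ↔
        (U₂ᵀ *ᵥ (D *ᵥ xbar) = 0 ∧
          ∀ z, U₂ᵀ *ᵥ z = 0 → fcon (D *ᵥ xbar) ≤ fcon z)) ∧
    (∀ zbar : Fin p → ℝ,
      U₂ᵀ *ᵥ zbar = 0 → (∀ z, U₂ᵀ *ᵥ z = 0 → fcon zbar ≤ fcon z) →
        zbar = D *ᵥ (Ddag *ᵥ zbar) ∧ ∀ x, fgen (Ddag *ᵥ zbar) ≤ fgen x) := by
  have hleft : ∀ x, Ddag *ᵥ (D *ᵥ x) = x := fun x => by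
    rw [mulVec_mulVec, hDdag, pinv_mul_self_of_rank_eq D hD, one_mulVec]
  have hrange : ∀ z, U₂ᵀ *ᵥ z = 0 ↔ ∃ x, D *ᵥ x = z := fun z => Set.ext_iff.1 hU₂ z
  have hval : ∀ x, fcon (D *ᵥ x) = fgen x := fun x => by
    simp only [hfcon, hfgen, hleft]
  refine ⟨fun xbar => ⟨fun h => ⟨(hrange _).2 ⟨xbar, rfl⟩, fun z hz => ?_⟩, fun h x => ?_⟩,
    fun zbar hz h => ?_⟩
  · obtain ⟨x, rfl⟩ := (hrange z).1 hz
    simpa only [hval] using h x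
  · simpa only [hval] using h.2 (D *ᵥ x) ((hrange _).2 ⟨x, rfl⟩)
  · obtain ⟨x, rfl⟩ := (hrange zbar).1 hz
    refine ⟨by rw [hleft], fun y => ?_⟩
    simpa only [hval, hleft] using h (D *ᵥ y) ((hrange _).2 ⟨y, rfl⟩)
end
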